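/- arXiv:2303.08164 — 2 statements merged into one kernel-verified Lean document; each statement's English description precedes it below -/
import Mathlib

section
/- Let m, n ≥ 1, let A be a real n×m matrix, let v*, μ ∈ ℝⁿ, and define the quadratic cost f(φ) = (1/2)‖v* − Aφ − μ‖² on ℝᵐ. Let lo ≤ hi (componentwise) in ℝᵐ define the box Q = {φ ∈ ℝᵐ : lo ≤ φ ≤ hi}, and let X* = argmin_{φ∈Q} f(φ) (nonempty since Q is compact and f is continuous). Let (Ω, ℱ, P) be a probability space with filtration (ℱ_k)_{k≥0}, let (γ_k)_{k≥1} be positive step sizes with Σ_{k≥1} γ_k = ∞ and Σ_{k≥1} γ_k² < ∞, let q_0 ∈ Q be deterministic, and let (ζ_k)_{k≥0} be random vectors in ℝᵐ with ζ_k measurable with respect to ℱ_{k+1}, E[ζ_k | ℱ_k] = 0 almost surely, and E[‖ζ_k‖²] ≤ σ for all k, for some constant σ > 0. Define recursively q_{k+1} = Π_{[lo,hi]}(q_k − γ_{k+1}(∇f(q_k) + ζ_k)). Then, almost surely, the sequence (q_k) converges to a point of X*. -/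
open Matrix MeasureTheory Filter

open scoped RealInnerProductSpace

/-- Nonnegative functions whose integrals are summable are almost everywhere summable. -/
theorem ae_summable_of_summable_integral {Ω : Type*} {m0 : MeasurableSpace Ω} {P : Measure Ω}
    {g : ℕ → Ω → ℝ} (hg0 : ∀ k ω, 0 ≤ g k ω) (hgi : ∀ k, Integrable (g k) P)
    (hs : Summable fun k => ∫ ω, g k ω ∂P) : ∀ᵐ ω ∂P, Summable fun k => g k ω := by
  have hfin : ∫⁻ ω, ∑' k, ENNReal.ofReal (g k ω) ∂P ≠ ⊤ := by
    rw [lintegral_tsum fun k => (hgi k).aemeasurable.ennreal_ofReal]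
    simp_rw [← ofReal_integral_eq_lintegral_ofReal (hgi _) (Eventually.of_forall (hg0 _))]
    exact hs.tsum_ofReal_ne_top
  filter_upwards [ae_lt_top' (AEMeasurable.tsum
    fun k => (hgi k).aemeasurable.ennreal_ofReal) hfin] with ω hω
  simpa [ENNReal.toReal_ofReal (hg0 _ ω)] using ENNReal.summable_toReal hω.ne

/-- A series of square-integrable martingale differences with summable second moments converges
almost surely. -/
theorem ae_exists_tendsto_sum_of_condExp_eq_zero {Ω : Type*} {m0 : MeasurableSpace Ω}
    {P : Measure Ω} [IsProbabilityMeasure P] {ℱ : Filtration ℕ m0} {D : ℕ → Ω → ℝ}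
    (hmeas : ∀ k, StronglyMeasurable[ℱ (k + 1)] (D k)) (hL2 : ∀ k, MemLp (D k) 2 P)
    (hmean : ∀ k, P[D k | ℱ k] =ᵐ[P] 0) (hs : Summable fun k => ∫ ω, D k ω ^ 2 ∂P) :
    ∀ᵐ ω ∂P, ∃ l, Tendsto (fun N => ∑ k ∈ Finset.range N, D k ω) atTop (nhds l) := by
  set M : ℕ → Ω → ℝ := fun N ω => ∑ k ∈ Finset.range N, D k ω with hM
  have hsucc : ∀ N, M (N + 1) = M N + D N := fun N => by
    ext ω; simp [hM, Finset.sum_range_succ]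
  have hMmeas : ∀ N, StronglyMeasurable[ℱ N] (M N) := fun N =>
    Finset.stronglyMeasurable_fun_sum _ fun k hk =>
      (hmeas k).mono (ℱ.mono (Finset.mem_range.1 hk))
  have hML2 : ∀ N, MemLp (M N) 2 P := fun N => memLp_finsetSum _ fun k _ => hL2 k
  have hmart : Martingale M ℱ P := by
    refine martingale_of_condExp_sub_eq_zero_nat hMmeas
      (fun N => (hML2 N).integrable one_le_two) fun N => ?_
    rw [hsucc, add_sub_cancel_left]
    exact hmean N
  have hcross : ∀ N, ∫ ω, (M N * D N) ω ∂P = 0 := fun N => by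
    have h := condExp_mul_of_stronglyMeasurable_left (hMmeas N)
      ((hML2 N).integrable_mul (hL2 N)) ((hL2 N).integrable one_le_two)
    rw [← integral_condExp (ℱ.le N), integral_congr_ae h]
    refine integral_eq_zero_of_ae ?_
    filter_upwards [hmean N] with ω hω
    simp [hω]
  have hsq : ∀ N, ∫ ω, M N ω ^ 2 ∂P = ∑ k ∈ Finset.range N, ∫ ω, D k ω ^ 2 ∂P := fun N => by
    induction N with
    | zero => simp [hM]
    | succ N ih =>
      rw [Finset.sum_range_succ, ← ih, hsucc]
      have hi := ((hML2 N).integrable_mul (hL2 N)).const_mul 2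
      have hi' : Integrable (fun ω => M N ω ^ 2 + D N ω ^ 2) P :=
        (hML2 N).integrable_sq.add (hL2 N).integrable_sq
      have : ∀ ω, (M N + D N) ω ^ 2 = M N ω ^ 2 + D N ω ^ 2 + 2 * (M N * D N) ω := fun ω => by
        simp only [Pi.add_apply, Pi.mul_apply]; ring
      simp_rw [this]
      rw [integral_add hi' hi,
        integral_add (hML2 N).integrable_sq (hL2 N).integrable_sq, integral_const_mul, hcross]
      ring
  refine hmart.submartingale.exists_ae_tendsto_of_bdd
    (R := (1 + ∑' k, ∫ ω, D k ω ^ 2 ∂P).toNNReal) fun N => ?_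
  have hint := (hML2 N).integrable one_le_two
  rw [eLpNorm_one_eq_lintegral_enorm, ← ofReal_integral_norm_eq_lintegral_enorm hint]
  refine ENNReal.ofReal_le_ofReal ?_
  calc ∫ ω, ‖M N ω‖ ∂P ≤ ∫ ω, (1 + M N ω ^ 2) ∂P := by
        refine integral_mono hint.norm ((integrable_const _).add (hML2 N).integrable_sq) fun ω => ?_
        simp only [Real.norm_eq_abs]
        nlinarith [sq_nonneg (|M N ω| - 1), sq_abs (M N ω)]
    _ = 1 + ∑ k ∈ Finset.range N, ∫ ω, D k ω ^ 2 ∂P := by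
        rw [integral_add (integrable_const _) (hML2 N).integrable_sq, hsq]; simp
    _ ≤ _ := by
        gcongr
        exact hs.sum_le_tsum _ fun k _ => integral_nonneg fun ω => sq_nonneg _

/-- Weighted inner products of a bounded predictable process with a centered noise of bounded
variance form an almost surely convergent series. -/
theorem ae_exists_tendsto_sum_mul_inner {E Ω : Type*} [NormedAddCommGroup E]
    [InnerProductSpace ℝ E] [CompleteSpace E] {m0 : MeasurableSpace Ω}
    {P : Measure Ω} [IsProbabilityMeasure P] {ℱ : Filtration ℕ m0} {γ : ℕ → ℝ}
    (hγ : Summable fun k => γ k ^ 2) {ζ Y : ℕ → Ω → E} {σ C : ℝ}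
    (hζ_meas : ∀ k, StronglyMeasurable[ℱ (k + 1)] (ζ k)) (hζ_mean : ∀ k, P[ζ k | ℱ k] =ᵐ[P] 0)
    (hζ_L2 : ∀ k, MemLp (ζ k) 2 P) (hζ_var : ∀ k, ∫ ω, ‖ζ k ω‖ ^ 2 ∂P ≤ σ)
    (hY_meas : ∀ k, StronglyMeasurable[ℱ k] (Y k)) (hY : ∀ k ω, ‖Y k ω‖ ≤ C) :
    ∀ᵐ ω ∂P, ∃ l, Tendsto (fun N => ∑ k ∈ Finset.range N, γ k * ⟪Y k ω, ζ k ω⟫) atTop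
      (nhds l) := by
  have hbound : ∀ k ω, ‖⟪Y k ω, ζ k ω⟫‖ ≤ C * ‖ζ k ω‖ := fun k ω =>
    (norm_inner_le_norm _ _).trans (by gcongr; exact hY k ω)
  have hmeas : ∀ k, StronglyMeasurable[ℱ (k + 1)] fun ω => ⟪Y k ω, ζ k ω⟫ := fun k =>
    ((hY_meas k).mono (ℱ.mono k.le_succ)).inner (hζ_meas k)
  have hL2 : ∀ k, MemLp (fun ω => ⟪Y k ω, ζ k ω⟫) 2 P := fun k =>
    (hζ_L2 k).of_le_mul ((hmeas k).mono (ℱ.le _)).aestronglyMeasurable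
      (Eventually.of_forall (hbound k))
  have hvar : ∀ k, ∫ ω, ⟪Y k ω, ζ k ω⟫ ^ 2 ∂P ≤ C ^ 2 * σ := fun k => by
    calc ∫ ω, ⟪Y k ω, ζ k ω⟫ ^ 2 ∂P ≤ ∫ ω, C ^ 2 * ‖ζ k ω‖ ^ 2 ∂P := by
          refine integral_mono (hL2 k).integrable_sq
            ((hζ_L2 k).integrable_norm_pow two_ne_zero |>.const_mul _) fun ω => ?_
          simp only
          rw [← mul_pow, ← sq_abs]
          exact pow_le_pow_left₀ (abs_nonneg _) (hbound k ω) 2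
      _ ≤ _ := by
          rw [integral_const_mul]
          exact mul_le_mul_of_nonneg_left (hζ_var k) (sq_nonneg C)
  refine ae_exists_tendsto_sum_of_condExp_eq_zero (fun k => (hmeas k).const_mul (γ k))
    (fun k => (hL2 k).const_mul (γ k)) (fun k => ?_) ?_
  · have h := condExp_bilin_of_stronglyMeasurable_left (innerSL ℝ) (hY_meas k)
      ((hL2 k).integrable one_le_two) ((hζ_L2 k).integrable one_le_two)
    refine (condExp_smul (γ k) (fun ω => innerSL ℝ (Y k ω) (ζ k ω)) (ℱ k)).trans ?_
    filter_upwards [h, hζ_mean k] with ω hω hω'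
    rw [Pi.smul_apply, hω, hω']
    simp
  · refine Summable.of_nonneg_of_le (fun k => integral_nonneg fun ω => sq_nonneg _) (fun k => ?_)
      (hγ.mul_right (C ^ 2 * σ))
    simp_rw [mul_pow]
    rw [integral_const_mul]
    exact mul_le_mul_of_nonneg_left (hvar k) (sq_nonneg _)

/-- A real sequence that is nonincreasing up to a convergent series of errors converges, and the
total decrease is summable. -/
theorem exists_tendsto_and_summable_of_le_sub_add {d b e : ℕ → ℝ} {l : ℝ} (hd : ∀ k, 0 ≤ d k)
    (hb : ∀ k, 0 ≤ b k) (he : Tendsto (fun N => ∑ k ∈ Finset.range N, e k) atTop (nhds l))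
    (hrec : ∀ k, d (k + 1) ≤ d k - b k + e k) :
    (∃ c, Tendsto d atTop (nhds c)) ∧ Summable b := by
  set S : ℕ → ℝ := fun N => ∑ k ∈ Finset.range N, e k with hS
  have hSsucc : ∀ N, S (N + 1) = S N + e N := fun N => Finset.sum_range_succ _ _
  obtain ⟨B, hB⟩ := he.bddAbove_range
  have hSB : ∀ N, S N ≤ B := fun N => hB ⟨N, rfl⟩
  have hanti : Antitone fun N => d N - S N := antitone_nat_of_succ_le fun N => by
    rw [hSsucc]; linarith [hrec N, hb N]
  have hbdd : BddBelow (Set.range fun N => d N - S N) := by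
    refine ⟨-B, ?_⟩
    rintro _ ⟨N, rfl⟩
    simp only
    linarith [hd N, hSB N]
  refine ⟨⟨_, by simpa using (tendsto_atTop_ciInf hanti hbdd).add he⟩, ?_⟩
  refine summable_of_sum_range_le (c := d 0 + B) hb fun N => ?_
  have : ∑ k ∈ Finset.range N, b k ≤ d 0 - d N + S N := by
    induction N with
    | zero => simp [hS]
    | succ N ih => rw [Finset.sum_range_succ, hSsucc]; linarith [hrec N]
  linarith [hd N, hSB N]

/-- A sequence in a compact set which is quasi-Fejér monotone with respect to the minimizers of `f`,
with decrease proportional to the optimality gap and nonsummable weights, converges to a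
minimizer. -/
theorem exists_tendsto_isMinOn_of_quasiFejer {E : Type*} [NormedAddCommGroup E] {Q : Set E}
    (hQ : IsCompact Q) {f : E → ℝ} (hf : Continuous f) {q : ℕ → E} (hq : ∀ k, q k ∈ Q)
    {a : ℕ → ℝ} (ha : ∀ k, 0 ≤ a k) (hadiv : ¬ Summable a)
    (hrec : ∀ x ∈ Q, IsMinOn f Q x → ∃ (e : ℕ → ℝ) (l : ℝ),
      Tendsto (fun N => ∑ k ∈ Finset.range N, e k) atTop (nhds l) ∧
      ∀ k, ‖q (k + 1) - x‖ ^ 2 ≤ ‖q k - x‖ ^ 2 - a k * (f (q k) - f x) + e k) :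
    ∃ x ∈ Q, IsMinOn f Q x ∧ Tendsto q atTop (nhds x) := by
  have key : ∀ x ∈ Q, IsMinOn f Q x → (∃ c, Tendsto (fun k => ‖q k - x‖ ^ 2) atTop (nhds c)) ∧
      Summable fun k => a k * (f (q k) - f x) := fun x hx hmin => by
    obtain ⟨e, l, he, h⟩ := hrec x hx hmin
    exact exists_tendsto_and_summable_of_le_sub_add (fun k => sq_nonneg _)
      (fun k => mul_nonneg (ha k) (sub_nonneg.2 (hmin (hq k)))) he h
  obtain ⟨x₀, hx₀, hmin₀⟩ := hQ.exists_isMinOn ⟨_, hq 0⟩ hf.continuousOn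
  have hfreq : ∀ ε > 0, ∃ᶠ k in atTop, f (q k) < f x₀ + ε := by
    intro ε hε hev
    refine hadiv ?_
    have hs := (key x₀ hx₀ hmin₀).2.mul_left ε⁻¹
    refine Summable.of_norm_bounded_eventually_nat hs ?_
    filter_upwards [hev] with k hk
    rw [Real.norm_of_nonneg (ha k), ← div_eq_inv_mul, le_div_iff₀ hε]
    exact mul_le_mul_of_nonneg_left (by linarith [not_lt.1 hk]) (ha k)
  have hcl : MapClusterPt (f x₀) atTop fun k => f (q k) := by
    rw [Metric.nhds_basis_ball.mapClusterPt_iff_frequently]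
    refine fun ε hε => (hfreq ε hε).mono fun k hk => ?_
    have : f x₀ ≤ f (q k) := hmin₀ (hq k)
    rw [Metric.mem_ball, Real.dist_eq, abs_lt]
    constructor <;> linarith
  obtain ⟨ψ, hψ, hfψ⟩ := hcl.tendsto_subseq
  obtain ⟨x, hx, θ, hθ, hqx⟩ := hQ.tendsto_subseq fun k => hq (ψ k)
  have hfx : f x = f x₀ := tendsto_nhds_unique ((hf.tendsto x).comp hqx) (hfψ.comp hθ.tendsto_atTop)
  have hmin : IsMinOn f Q x := fun y hy => by
    simpa [hfx] using hmin₀ hy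
  refine ⟨x, hx, hmin, ?_⟩
  obtain ⟨c, hc⟩ := (key x hx hmin).1
  have h0 : Tendsto (fun k => ‖q (ψ (θ k)) - x‖ ^ 2) atTop (nhds 0) := by
    simpa using ((tendsto_iff_norm_sub_tendsto_zero.1 hqx).pow 2)
  have hc0 : c = 0 := tendsto_nhds_unique (hc.comp (hψ.comp hθ).tendsto_atTop) h0
  subst hc0
  rw [tendsto_iff_norm_sub_tendsto_zero]
  simpa using hc.sqrt

/-- First-order convexity inequality for the least-squares cost. -/
theorem half_norm_sq_sub_le_inner_toEuclideanLin {m n : ℕ} (A : Matrix (Fin n) (Fin m) ℝ)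
    (v μ : EuclideanSpace ℝ (Fin n)) (φ x : EuclideanSpace ℝ (Fin m)) :
    1 / 2 * ‖v - toEuclideanLin A φ - μ‖ ^ 2 - 1 / 2 * ‖v - toEuclideanLin A x - μ‖ ^ 2 ≤
      ⟪φ - x, -(toEuclideanLin Aᵀ (v - toEuclideanLin A φ - μ))⟫ := by
  rw [← conjTranspose_eq_transpose_of_trivial, toEuclideanLin_conjTranspose_eq_adjoint,
    inner_neg_right, LinearMap.adjoint_inner_right, map_sub]
  set r := v - toEuclideanLin A φ - μ with hr
  set d := toEuclideanLin A φ - toEuclideanLin A x with hd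
  have : v - toEuclideanLin A x - μ = d + r := by rw [hr, hd]; abel
  rw [this, norm_add_sq_real]
  nlinarith [sq_nonneg ‖d‖]

/-- The componentwise clamp onto a box does not increase the distance to points of the box. -/
theorem norm_clamp_sub_le {m : ℕ} {lo hi y p x : EuclideanSpace ℝ (Fin m)}
    (hp : ∀ i, p i = max (lo i) (min (hi i) (y i))) (hx : ∀ i, lo i ≤ x i ∧ x i ≤ hi i) :
    ‖p - x‖ ≤ ‖y - x‖ := by
  rw [EuclideanSpace.norm_eq, EuclideanSpace.norm_eq]
  refine Real.sqrt_le_sqrt (Finset.sum_le_sum fun i _ => ?_)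
  refine pow_le_pow_left₀ (norm_nonneg _) ?_ 2
  have hxi : x i = max (lo i) (min (hi i) (x i)) := by
    rw [min_eq_right (hx i).2, max_eq_right (hx i).1]
  rw [PiLp.sub_apply, PiLp.sub_apply, hp, Real.norm_eq_abs, Real.norm_eq_abs]
  nth_rewrite 1 [hxi]
  refine (abs_max_sub_max_le_max _ _ _ _).trans (max_le (by simp) ?_)
  exact (abs_min_sub_min_le_max _ _ _ _).trans (max_le (by simp) le_rfl)

/-- Coordinate boxes in Euclidean space are compact. -/
theorem isCompact_setOf_forall_le_le {m : ℕ} (lo hi : EuclideanSpace ℝ (Fin m)) :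
    IsCompact {φ : EuclideanSpace ℝ (Fin m) | ∀ i, lo i ≤ φ i ∧ φ i ≤ hi i} := by
  have h := isCompact_univ_pi fun i => isCompact_Icc (a := lo i) (b := hi i)
  have := (EuclideanSpace.equiv (Fin m) ℝ).symm.toHomeomorph.isCompact_image.2 h
  convert this using 1
  rw [← Homeomorph.preimage_symm]
  ext φ
  simp [Pi.le_def, forall_and]

/-- Proposition 1 of the paper: almost-sure convergence of the one-step projected
stochastic gradient descent controller. With the quadratic cost
`f(φ) = (1/2)‖v* − Aφ − μ‖²` (gradient `∇f(φ) = −Aᵀ(v* − Aφ − μ)`), the box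
`Q = [lo, hi]`, the solution set `X* = argmin_Q f`, a filtration `(ℱ_k)`,
positive step sizes with `Σγ_k = ∞`, `Σγ_k² < ∞`, noise `ζ_k` that is
`ℱ_{k+1}`-measurable with `E[ζ_k | ℱ_k] = 0` a.s. and `E[‖ζ_k‖²] ≤ σ`, and the
recursion `q_{k+1} = Π_{[lo,hi]}(q_k − γ_{k+1}(∇f(q_k) + ζ_k))` started from a
deterministic `q_0 ∈ Q`, the sequence `(q_k)` converges almost surely to a point
of `X*`. -/
theorem stmt0 {m n : ℕ} (hm : 1 ≤ m) (hn : 1 ≤ n)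
    (A : Matrix (Fin n) (Fin m) ℝ) (vstar μ : EuclideanSpace ℝ (Fin n))
    (f : EuclideanSpace ℝ (Fin m) → ℝ)
    (hf : ∀ φ, f φ = (1/2) * ‖vstar - Matrix.toEuclideanLin A φ - μ‖^2)
    (gradf : EuclideanSpace ℝ (Fin m) → EuclideanSpace ℝ (Fin m))
    (hgradf : ∀ φ, gradf φ = -(Matrix.toEuclideanLin Aᵀ (vstar - Matrix.toEuclideanLin A φ - μ)))
    (lo hi : EuclideanSpace ℝ (Fin m)) (hlohi : ∀ i, lo i ≤ hi i)
    (Q : Set (EuclideanSpace ℝ (Fin m)))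
    (hQ : Q = {φ | ∀ i, lo i ≤ φ i ∧ φ i ≤ hi i})
    (Xstar : Set (EuclideanSpace ℝ (Fin m)))
    (hXstar : Xstar = {φ | φ ∈ Q ∧ ∀ ψ ∈ Q, f φ ≤ f ψ})
    (proj : EuclideanSpace ℝ (Fin m) → EuclideanSpace ℝ (Fin m))
    (hproj : ∀ x i, proj x i = max (lo i) (min (hi i) (x i)))
    {Ω : Type*} {m0 : MeasurableSpace Ω} (P : Measure Ω) [IsProbabilityMeasure P]
    (ℱ : Filtration ℕ m0)
    (γ : ℕ → ℝ) (hγpos : ∀ k, 1 ≤ k → 0 < γ k)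
    (hγdiv : ¬ Summable (fun k => γ (k + 1)))
    (hγsq : Summable (fun k => (γ (k + 1))^2))
    (q0 : EuclideanSpace ℝ (Fin m)) (hq0 : q0 ∈ Q)
    (ζ : ℕ → Ω → EuclideanSpace ℝ (Fin m))
    (σ : ℝ) (hσ : 0 < σ)
    (hζ_meas : ∀ k, Measurable[ℱ (k + 1)] (ζ k))
    (hζ_int : ∀ k, Integrable (ζ k) P)
    (hζ_mean : ∀ k, P[ζ k | ℱ k] =ᵐ[P] 0)
    (hζ_sq_int : ∀ k, Integrable (fun ω => ‖ζ k ω‖^2) P)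
    (hζ_var : ∀ k, ∫ ω, ‖ζ k ω‖^2 ∂P ≤ σ)
    (q : ℕ → Ω → EuclideanSpace ℝ (Fin m))
    (hqinit : ∀ ω, q 0 ω = q0)
    (hqrec : ∀ k ω, q (k + 1) ω = proj (q k ω - γ (k + 1) • (gradf (q k ω) + ζ k ω))) :
    ∀ᵐ ω ∂P, ∃ x ∈ Xstar, Tendsto (fun k => q k ω) atTop (nhds x) := by
  have hγpos' : ∀ k, 0 < γ (k + 1) := fun k => hγpos _ k.succ_pos
  have hQc : IsCompact Q := hQ ▸ isCompact_setOf_forall_le_le lo hi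
  have hLA : Continuous (toEuclideanLin A) := LinearMap.continuous_of_finiteDimensional _
  have hLAt : Continuous (toEuclideanLin Aᵀ) := LinearMap.continuous_of_finiteDimensional _
  have hfc : Continuous f := by
    rw [funext hf]; fun_prop
  have hgc : Continuous gradf := by
    rw [funext hgradf]; fun_prop
  have hpc : Continuous proj := by
    have : proj = fun x => WithLp.toLp 2 fun i => max (lo i) (min (hi i) (x i)) := by
      ext x i; simp [hproj]
    rw [this]; fun_prop
  have hqQ : ∀ k ω, q k ω ∈ Q := by
    rintro (_ | k) ω
    · rwa [hqinit]
    · rw [hqrec, hQ]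
      intro i
      rw [hproj]
      exact ⟨le_max_left _ _, max_le (hlohi i) (min_le_left _ _)⟩
  have hζm : ∀ k, StronglyMeasurable[ℱ (k + 1)] (ζ k) := fun k => (hζ_meas k).stronglyMeasurable
  have hζL2 : ∀ k, MemLp (ζ k) 2 P := fun k =>
    (memLp_two_iff_integrable_sq_norm (hζ_int k).aestronglyMeasurable).2 (hζ_sq_int k)
  have hqm : ∀ k, StronglyMeasurable[ℱ k] (q k) := by
    intro k
    induction k with
    | zero => rw [funext hqinit]; exact stronglyMeasurable_const
    | succ k ih =>
      have ih' := ih.mono (ℱ.mono k.le_succ)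
      rw [funext (hqrec k)]
      exact hpc.comp_stronglyMeasurable
        (ih'.sub (((hgc.comp_stronglyMeasurable ih').add (hζm k)).const_smul (γ (k + 1))))
  obtain ⟨C, hC⟩ := hQc.isBounded.exists_norm_le
  obtain ⟨G, hG⟩ := (hQc.image hgc).isBounded.exists_norm_le
  have hqζ := ae_exists_tendsto_sum_mul_inner hγsq hζm hζ_mean hζL2 hζ_var hqm
    fun k ω => hC _ (hqQ k ω)
  have hcoord : ∀ᵐ ω ∂P, ∀ i, ∃ l,
      Tendsto (fun N => ∑ k ∈ Finset.range N, γ (k + 1) * ζ k ω i) atTop (nhds l) := by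
    refine ae_all_iff.2 fun i => ?_
    simpa [EuclideanSpace.inner_single_left] using ae_exists_tendsto_sum_mul_inner hγsq hζm hζ_mean hζL2 hζ_var
      (Y := fun _ _ => EuclideanSpace.single i 1) (fun k => stronglyMeasurable_const)
      fun k ω => le_rfl
  have hsq : ∀ᵐ ω ∂P, Summable fun k => γ (k + 1) ^ 2 * ‖ζ k ω‖ ^ 2 := by
    refine ae_summable_of_summable_integral (fun k ω => by positivity)
      (fun k => (hζ_sq_int k).const_mul _) ?_
    refine Summable.of_nonneg_of_le (fun k => integral_nonneg fun ω => by positivity)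
      (fun k => ?_) (hγsq.mul_right σ)
    rw [integral_const_mul]
    exact mul_le_mul_of_nonneg_left (hζ_var k) (sq_nonneg _)
  filter_upwards [hqζ, hcoord, hsq] with ω ⟨l₁, hl₁⟩ hω₂ hω₃
  choose l₂ hl₂ using hω₂
  have hadiv : ¬ Summable fun k => 2 * γ (k + 1) := by
    rwa [summable_mul_left_iff two_ne_zero]
  have hfejer : ∀ x ∈ Q, IsMinOn f Q x → ∃ (e : ℕ → ℝ) (l : ℝ),
      Tendsto (fun N => ∑ k ∈ Finset.range N, e k) atTop (nhds l) ∧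
      ∀ k, ‖q (k + 1) ω - x‖ ^ 2 ≤
        ‖q k ω - x‖ ^ 2 - 2 * γ (k + 1) * (f (q k ω) - f x) + e k := by
    intro x hx _
    refine ⟨fun k => -2 * (γ (k + 1) * ⟪q k ω, ζ k ω⟫)
      + 2 * ∑ i, x i * (γ (k + 1) * ζ k ω i)
      + (2 * G ^ 2 * γ (k + 1) ^ 2 + 2 * (γ (k + 1) ^ 2 * ‖ζ k ω‖ ^ 2)),
      -2 * l₁ + 2 * ∑ i, x i * l₂ i + (2 * G ^ 2 * ∑' k, γ (k + 1) ^ 2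
        + 2 * ∑' k, γ (k + 1) ^ 2 * ‖ζ k ω‖ ^ 2), ?_, fun k => ?_⟩
    · simp_rw [Finset.sum_add_distrib, ← Finset.mul_sum]
      simp_rw [Finset.sum_comm (s := Finset.range _), ← Finset.mul_sum]
      exact ((hl₁.const_mul _).add
        ((tendsto_finsetSum _ fun i _ => (hl₂ i).const_mul (x i)).const_mul 2)).add
        ((hγsq.hasSum.tendsto_sum_nat.const_mul _).add (hω₃.hasSum.tendsto_sum_nat.const_mul _))
    · have hproj_le : ‖q (k + 1) ω - x‖ ≤
          ‖(q k ω - x) - γ (k + 1) • (gradf (q k ω) + ζ k ω)‖ := by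
        rw [sub_right_comm, hqrec]
        exact norm_clamp_sub_le (hproj _) (by simpa [hQ] using hx)
      have hconv : f (q k ω) - f x ≤ ⟪q k ω - x, gradf (q k ω)⟫ := by
        rw [hf, hf, hgradf]
        exact half_norm_sq_sub_le_inner_toEuclideanLin A vstar μ _ _
      have hsum : ∑ i, x i * (γ (k + 1) * ζ k ω i) = γ (k + 1) * ⟪x, ζ k ω⟫ := by
        rw [PiLp.inner_apply, Finset.mul_sum]
        exact Finset.sum_congr rfl fun i _ => by simp; ring
      have hnorm : ‖gradf (q k ω) + ζ k ω‖ ^ 2 ≤ 2 * G ^ 2 + 2 * ‖ζ k ω‖ ^ 2 := by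
        have h₁ := norm_add_le (gradf (q k ω)) (ζ k ω)
        have h₂ := hG _ (Set.mem_image_of_mem gradf (hqQ k ω))
        have h₃ := norm_nonneg (gradf (q k ω))
        have h₄ := pow_le_pow_left₀ (norm_nonneg _) h₁ 2
        nlinarith [sq_nonneg (‖gradf (q k ω)‖ - ‖ζ k ω‖), pow_le_pow_left₀ h₃ h₂ 2]
      beta_reduce
      rw [hsum]
      refine (pow_le_pow_left₀ (norm_nonneg _) hproj_le 2).trans ?_
      rw [norm_sub_sq_real, norm_smul, mul_pow, Real.norm_eq_abs, sq_abs, inner_smul_right,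
        inner_add_right, inner_sub_left _ _ (ζ k ω)]
      have h₁ := mul_le_mul_of_nonneg_left hconv (hγpos' k).le
      have h₂ := mul_le_mul_of_nonneg_left hnorm (sq_nonneg (γ (k + 1)))
      linarith
  obtain ⟨x, hx, hmin, hlim⟩ := exists_tendsto_isMinOn_of_quasiFejer hQc hfc
    (fun k => hqQ k ω) (fun k => (mul_pos two_pos (hγpos' k)).le) hadiv hfejer
  exact ⟨x, hXstar ▸ ⟨hx, fun ψ hψ => hmin hψ⟩, hlim⟩
end

section
/- Let m, n ≥ 1, let A be a real n×m matrix, v*, μ ∈ ℝⁿ, and f(φ) = (1/2)‖v* − Aφ − μ‖² on ℝᵐ. Let lo ≤ hi in ℝᵐ define the box Q = {φ : lo ≤ φ ≤ hi}, let q_T ∈ Q, and let q* be a minimizer of f over Q. Let λ ∈ (0,1], let Δq_1, …, Δq_T ∈ ℝᵐ, let ζ_T ∈ ℝᵐ with ‖ζ_T‖ ≤ B, let γ_T ∈ (0,1], and suppose Δq_T = −γ_T(∇f(q_T) + ζ_T). If α ∈ ℝ is such that αI − Σ_{l=1}^T λ^{T−l} Δq_l Δq_lᵀ is positive definite, then f(q_T)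 − f(q*) ≤ ‖hi − lo‖ · (√(mα) + B)/γ_T. -/
open Matrix

/-- The last vector of an exponentially weighted Gram sum dominated by `α • 1` has norm at most
`√α`. -/
theorem norm_le_sqrt_of_weighted_gram_lt {m : ℕ} {c α : ℝ} (hc : 0 ≤ c) {T : ℕ} (hT : 1 ≤ T)
    (u : ℕ → EuclideanSpace ℝ (Fin m))
    (hPD : (α • (1 : Matrix (Fin m) (Fin m) ℝ)
      - ∑ l ∈ Finset.Icc 1 T, c ^ (T - l) • Matrix.vecMulVec (u l) (u l)).PosDef) :
    ‖u T‖ ≤ Real.sqrt α := by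
  rcases (norm_nonneg (u T)).eq_or_lt with h0 | hpos
  · rw [← h0]
    exact Real.sqrt_nonneg α
  have hquad := hPD.posSemidef.dotProduct_mulVec_nonneg (u T).ofLp
  have hself : (u T).ofLp ⬝ᵥ (u T).ofLp = ‖u T‖ ^ 2 := by
    rw [EuclideanSpace.real_norm_sq_eq]
    simp [dotProduct, sq]
  simp only [star_trivial, Matrix.sub_mulVec, Matrix.smul_mulVec, Matrix.one_mulVec,
    Matrix.sum_mulVec, dotProduct_sub, dotProduct_smul, dotProduct_sum, Matrix.vecMulVec_mulVec,
    smul_eq_mul, hself, op_smul_eq_smul] at hquad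
  have hterm : ‖u T‖ ^ 2 * ‖u T‖ ^ 2 ≤ ∑ l ∈ Finset.Icc 1 T,
      c ^ (T - l) * (((u l).ofLp ⬝ᵥ (u T).ofLp) * ((u T).ofLp ⬝ᵥ (u l).ofLp)) := by
    have := Finset.single_le_sum (s := Finset.Icc 1 T)
      (f := fun l => c ^ (T - l) * (((u l).ofLp ⬝ᵥ (u T).ofLp) * ((u T).ofLp ⬝ᵥ (u l).ofLp)))
      (fun l _ => mul_nonneg (pow_nonneg hc _)
        (by rw [dotProduct_comm]; exact mul_self_nonneg _))
      (Finset.mem_Icc.2 ⟨hT, le_rfl⟩)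
    simpa [hself] using this
  apply Real.le_sqrt_of_sq_le
  exact le_of_mul_le_mul_right (by linarith) (pow_pos hpos 2)

/-- First-order convexity bound for a least-squares cost. -/
theorem half_norm_sq_residual_sub_le_inner {m n : ℕ} (A : Matrix (Fin n) (Fin m) ℝ)
    (b : EuclideanSpace ℝ (Fin n)) (x y : EuclideanSpace ℝ (Fin m)) :
    (1 / 2) * ‖b - Matrix.toEuclideanLin A x‖ ^ 2 - (1 / 2) * ‖b - Matrix.toEuclideanLin A y‖ ^ 2
      ≤ inner ℝ (-(Matrix.toEuclideanLin Aᵀ (b - Matrix.toEuclideanLin A x))) (x - y) := by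
  have hadj : inner ℝ (Matrix.toEuclideanLin Aᵀ (b - Matrix.toEuclideanLin A x)) (x - y)
      = inner ℝ (b - Matrix.toEuclideanLin A x) (Matrix.toEuclideanLin A (x - y)) := by
    rw [← Matrix.conjTranspose_eq_transpose_of_trivial,
      Matrix.toEuclideanLin_conjTranspose_eq_adjoint, LinearMap.adjoint_inner_left]
  have hres : b - Matrix.toEuclideanLin A y
      = (b - Matrix.toEuclideanLin A x) + Matrix.toEuclideanLin A (x - y) := by
    rw [map_sub]; abel
  rw [inner_neg_left, hadj, hres, norm_add_sq_real]
  nlinarith [sq_nonneg ‖Matrix.toEuclideanLin A (x - y)‖]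

/-- Two points of a box are at distance at most the length of its diagonal. -/
theorem norm_sub_le_of_mem_box {m : ℕ} {lo hi x y : EuclideanSpace ℝ (Fin m)}
    (hx : ∀ i, lo i ≤ x i ∧ x i ≤ hi i) (hy : ∀ i, lo i ≤ y i ∧ y i ≤ hi i) :
    ‖x - y‖ ≤ ‖hi - lo‖ := by
  rw [EuclideanSpace.norm_eq, EuclideanSpace.norm_eq]
  gcongr with i
  simp only [PiLp.sub_apply, Real.norm_eq_abs]
  have := hx i
  have := hy i
  exact (abs_le.2 ⟨by linarith, by linarith⟩).trans (le_abs_self _)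

/-- Proposition 2 of the paper: cost error bound at the time instant `T` when the
sequence of input increments ceases to be persistently exciting. Here
`f(φ) = (1/2)‖v* − Aφ − μ‖²`, `∇f(φ) = −Aᵀ(v* − Aφ − μ)`, `q_T` lies in the box
`[lo, hi]`, `q*` minimizes `f` over the box, `ΔqT = −γ(∇f(q_T) + ζ)` with
`‖ζ‖ ≤ B`, and `αI − Σ_{l=1}^T λ^{T−l} Δq_l Δq_lᵀ` is positive definite; then
`f(q_T) − f(q*) ≤ ‖hi − lo‖ · (√(mα) + B)/γ`. -/
theorem stmt1 {m n : ℕ} (hm : 1 ≤ m) (hn : 1 ≤ n)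
    (A : Matrix (Fin n) (Fin m) ℝ) (vstar μ : EuclideanSpace ℝ (Fin n))
    (f : EuclideanSpace ℝ (Fin m) → ℝ)
    (hf : ∀ φ, f φ = (1/2) * ‖vstar - Matrix.toEuclideanLin A φ - μ‖^2)
    (gradf : EuclideanSpace ℝ (Fin m) → EuclideanSpace ℝ (Fin m))
    (hgradf : ∀ φ, gradf φ = -(Matrix.toEuclideanLin Aᵀ (vstar - Matrix.toEuclideanLin A φ - μ)))
    (lo hi : EuclideanSpace ℝ (Fin m)) (hlohi : ∀ i, lo i ≤ hi i)
    (qT qstar : EuclideanSpace ℝ (Fin m))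
    (hqT : ∀ i, lo i ≤ qT i ∧ qT i ≤ hi i)
    (hqstar_mem : ∀ i, lo i ≤ qstar i ∧ qstar i ≤ hi i)
    (hqstar_min : ∀ ψ : EuclideanSpace ℝ (Fin m),
      (∀ i, lo i ≤ ψ i ∧ ψ i ≤ hi i) → f qstar ≤ f ψ)
    (lam : ℝ) (hlam0 : 0 < lam) (hlam1 : lam ≤ 1)
    (T : ℕ) (hT : 1 ≤ T)
    (Δq : ℕ → EuclideanSpace ℝ (Fin m))
    (ζ : EuclideanSpace ℝ (Fin m)) (B : ℝ) (hζB : ‖ζ‖ ≤ B)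
    (γ : ℝ) (hγ0 : 0 < γ) (hγ1 : γ ≤ 1)
    (hstep : Δq T = -(γ • (gradf qT + ζ)))
    (α : ℝ)
    (hPD : (α • (1 : Matrix (Fin m) (Fin m) ℝ)
        - ∑ l ∈ Finset.Icc 1 T, lam ^ (T - l) • Matrix.vecMulVec (Δq l) (Δq l)).PosDef) :
    f qT - f qstar ≤ ‖hi - lo‖ * (Real.sqrt (m * α) + B) / γ := by
  have hnorm : ‖Δq T‖ ≤ Real.sqrt (m * α) := by
    refine (norm_le_sqrt_of_weighted_gram_lt hlam0.le hT Δq hPD).trans ?_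
    rcases le_total α 0 with h | h
    · rw [Real.sqrt_eq_zero_of_nonpos h]
      exact Real.sqrt_nonneg _
    · exact Real.sqrt_le_sqrt (le_mul_of_one_le_left h (by exact_mod_cast hm))
  have hconv : f qT - f qstar ≤ inner ℝ (gradf qT) (qT - qstar) := by
    simpa only [hf, hgradf, sub_right_comm vstar _ μ] using
      half_norm_sq_residual_sub_le_inner A (vstar - μ) qT qstar
  have hgrad : ‖gradf qT‖ ≤ (Real.sqrt (m * α) + B) / γ := by
    rw [le_div_iff₀ hγ0]
    have hγgrad : γ • gradf qT = -(Δq T) - γ • ζ := by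
      rw [hstep, smul_add]; abel
    calc ‖gradf qT‖ * γ = ‖-(Δq T) - γ • ζ‖ := by
          rw [← hγgrad, norm_smul, Real.norm_of_nonneg hγ0.le, mul_comm]
      _ ≤ ‖Δq T‖ + γ * ‖ζ‖ := by
          refine (norm_sub_le _ _).trans_eq ?_
          rw [norm_neg, norm_smul, Real.norm_of_nonneg hγ0.le]
      _ ≤ Real.sqrt (m * α) + B :=
          add_le_add hnorm ((mul_le_of_le_one_left (norm_nonneg ζ) hγ1).trans hζB)
  calc f qT - f qstar ≤ ‖gradf qT‖ * ‖qT - qstar‖ := hconv.trans (real_inner_le_norm _ _)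
    _ ≤ (Real.sqrt (m * α) + B) / γ * ‖hi - lo‖ :=
        mul_le_mul hgrad (norm_sub_le_of_mem_box hqT hqstar_mem) (norm_nonneg _)
          ((norm_nonneg _).trans hgrad)
    _ = ‖hi - lo‖ * (Real.sqrt (m * α) + B) / γ := by ring
end
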